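/- arXiv:2501.01214 — 5 statements merged into one kernel-verified Lean document; each statement's English description precedes it below -/
import Mathlib

section
/- Let k ≥ 1 and n_1, …, n_k ≥ 1 be integers. Suppose F : ∏_{i=1}^k {0,1}^{n_i} → ∏_{i=1}^k {0,1}^{n_i} is bijective and partition-symmetric. Then there exist functions f_i : ∏_{ℓ=1}^k {0, 1, …, n_ℓ} → {0,1}, for 1 ≤ i ≤ k, such that for every input a, every i ∈ [k] and every j ∈ [n_i]: F(a)_{i,j} = a_{i,j} XOR f_i(|a_1|, …, |a_k|), where a_{i,j} denotes the j-th bit of the i-th block of a and |a_ℓ| denotes the Hamming weight (number of 1-bits) of the ℓ-th block. -/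
/-- The Hamming weight (number of `true` coordinates) of a Boolean vector. -/
def hammingWeight {N : ℕ} (v : Fin N → Bool) : ℕ :=
  (Finset.univ.filter fun j => v j = true).card

/-- The Hamming weight of a Boolean vector of length `N`, as an element of
`{0, 1, …, N}` (i.e. `Fin (N+1)`). -/
def hammingWeightFin {N : ℕ} (v : Fin N → Bool) : Fin (N + 1) :=
  ⟨hammingWeight v,
    Nat.lt_succ_of_le ((Finset.card_filter_le _ _).trans (by simp))⟩

/-- Boolean vectors of equal Hamming weight differ by a permutation of the coordinates. -/
theorem exists_perm_of_hammingWeight_eq {N : ℕ} {v w : Fin N → Bool}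
    (h : hammingWeight v = hammingWeight w) : ∃ σ : Equiv.Perm (Fin N), v ∘ σ = w := by
  have hcard : Fintype.card {j // w j = true} = Fintype.card {j // v j = true} := by
    simpa only [Fintype.card_subtype, hammingWeight] using h.symm
  let e : {j // w j = true} ≃ {j // v j = true} := Fintype.equivOfCardEq hcard
  refine ⟨e.extendSubtype, funext fun j => ?_⟩
  by_cases hj : w j = true
  · exact (e.extendSubtype_mem j hj).trans hj.symm
  · have := e.extendSubtype_not_mem j hj
    simp_all

/-- An injective map commuting with blockwise permutations preserves and reflects equality of
two coordinates within a block. -/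
theorem apply_eq_apply_iff_of_injective_of_comp_perm {ι : Type*} {κ : ι → Type*} {β : Type*}
    {F : (∀ i, κ i → β) → (∀ i, κ i → β)} (hF : Function.Injective F)
    (hsym : ∀ (σ : ∀ i, Equiv.Perm (κ i)) (a : ∀ i, κ i → β),
      F (fun i => a i ∘ ⇑(σ i)) = fun i => F a i ∘ ⇑(σ i))
    (a : ∀ i, κ i → β) (i : ι) (j j' : κ i) : F a i j = F a i j' ↔ a i j = a i j' := by
  classical
  let σ : ∀ l, Equiv.Perm (κ l) := Pi.mulSingle i (Equiv.swap j j')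
  have key (b : ∀ l, κ l → β) : (fun l => b l ∘ ⇑(σ l)) = b ↔ b i j = b i j' := by
    constructor
    · intro h
      simpa [σ] using (congrFun (congrFun h i) j).symm
    · intro h
      funext l x
      by_cases hl : l = i
      · subst hl
        simp only [σ, Pi.mulSingle_eq_same, Function.comp_apply, Equiv.swap_apply_def]
        split_ifs <;> simp_all
      · simp [σ, Pi.mulSingle_eq_of_ne hl]
  rw [← key, ← key, ← hsym, hF.eq_iff]

/-- Characterization of partition-symmetric reversible functions: any bijective
`F : ∏_i {0,1}^{n i} → ∏_i {0,1}^{n i}` commuting with the blockwise permutation action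
is given by XOR-ing each bit of block `i` with a function `f i` of the block weights. -/
theorem partition_symmetric_reversible_characterization (k : ℕ) (hk : 1 ≤ k)
    (n : Fin k → ℕ) (hn : ∀ i, 1 ≤ n i)
    (F : (∀ i, Fin (n i) → Bool) → (∀ i, Fin (n i) → Bool))
    (hbij : Function.Bijective F)
    (hsym : ∀ (σ : ∀ i, Equiv.Perm (Fin (n i))) (a : ∀ i, Fin (n i) → Bool),
      F (fun i => a i ∘ ⇑(σ i)) = fun i => F a i ∘ ⇑(σ i)) :
    ∃ f : Fin k → ((∀ ℓ, Fin (n ℓ + 1)) → Bool),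
      ∀ (a : ∀ i, Fin (n i) → Bool) (i : Fin k) (j : Fin (n i)),
        F a i j = xor (a i j) (f i fun ℓ => hammingWeightFin (a ℓ)) := by
  let c (i : Fin k) (a : ∀ i, Fin (n i) → Bool) : Bool := xor (a i ⟨0, hn i⟩) (F a i ⟨0, hn i⟩)
  have hF (a : ∀ i, Fin (n i) → Bool) (i : Fin k) (j : Fin (n i)) :
      F a i j = xor (a i j) (c i a) := by
    have h := apply_eq_apply_iff_of_injective_of_comp_perm hbij.injective hsym a i j ⟨0, hn i⟩
    simp only [c]
    revert h
    generalize F a i j = p, F a i ⟨0, hn i⟩ = q, a i j = r, a i ⟨0, hn i⟩ = s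
    revert p q r s
    decide
  let wt (a : ∀ i, Fin (n i) → Bool) : ∀ l, Fin (n l + 1) := fun l => hammingWeightFin (a l)
  have hc (i : Fin k) : (c i).FactorsThrough wt := by
    intro a b hab
    choose σ hσ using fun l =>
      exists_perm_of_hammingWeight_eq (congrArg Fin.val (congrFun hab l))
    obtain rfl : (fun l => a l ∘ ⇑(σ l)) = b := funext hσ
    have h := hF (fun l => a l ∘ ⇑(σ l)) i ⟨0, hn i⟩
    rw [hsym] at h
    simp only [Function.comp_apply, hF] at h
    exact Bool.xor_right_inj.mp h
  refine ⟨fun i => Function.extend wt (c i) fun _ => false, fun a i j => ?_⟩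
  rw [hF]
  exact congrArg _ ((hc i).extend_apply _ a).symm
end

section
/- Let W be a finite set, and let T_1, …, T_k be reversible threshold gates on W with data (S_1, h_1, t_1), …, (S_k, h_k, t_k) (where S_i ⊆ W, h_i ∈ W \ S_i, t_i ∈ ℕ). If the maps T_1, …, T_k pairwise commute, then for every assignment a : W → {0,1} and every w ∈ W, the composition satisfies (T_1 ∘ T_2 ∘ ⋯ ∘ T_k)(a)(w) = a(w) XOR (XOR over all i ∈ [k] with h_i = w of the bit [#{s ∈ S_i : a(s) = 1} ≥ t_i]). -/
/-- The reversible threshold gate `Thr(S, h, t)` on assignments `W → Bool`: it XORs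
the bit `[#{s ∈ S : a s = true} ≥ t]` onto coordinate `h` and leaves all other
coordinates unchanged. -/
def thrGate {W : Type*} [DecidableEq W] (S : Finset W) (h : W) (t : ℕ)
    (a : W → Bool) : W → Bool :=
  fun w => if w = h then xor (a h) (decide (t ≤ (S.filter fun s => a s = true).card))
           else a w

/-- If the gates `Thr(S, h, t)` and `Thr(S', h', t')` commute, then applying the second does not
change whether the first is triggered. -/
theorem thrGate_trigger_invariant {W : Type*} [DecidableEq W] {S S' : Finset W} {h h' : W}
    {t t' : ℕ} (hS : h ∉ S)
    (hcomm : thrGate S h t ∘ thrGate S' h' t' = thrGate S' h' t' ∘ thrGate S h t)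
    (a : W → Bool) :
    decide (t ≤ (S.filter fun s => thrGate S' h' t' a s = true).card)
      = decide (t ≤ (S.filter fun s => a s = true).card) := by
  by_cases hh : h = h'
  · subst hh
    have key : (S.filter fun s => thrGate S' h t' a s = true)
        = S.filter fun s => a s = true := by
      refine Finset.filter_congr fun s hs => ?_
      have hne : s ≠ h := fun e => hS (e ▸ hs)
      simp [thrGate, hne]
    rw [key]
  · have key := congrFun (congrFun hcomm a) h
    simp only [Function.comp_apply] at key
    have hB : ∀ b, thrGate S' h' t' b h = b h := fun b => by simp [thrGate, hh]
    have hA : ∀ b, thrGate S h t b h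
        = xor (b h) (decide (t ≤ (S.filter fun s => b s = true).card)) := fun b => by
      simp [thrGate]
    rw [hB, hA, hA, hB] at key
    exact Bool.xor_right_inj.mp key

/-- A function invariant under every map of a list is invariant under their composition. -/
theorem List.foldr_comp_invariant {α β : Type*} (f : α → β) (l : List (α → α))
    (hl : ∀ g ∈ l, ∀ a, f (g a) = f a) (a : α) : f (l.foldr (· ∘ ·) id a) = f a := by
  induction l with
  | nil => rfl
  | cons g l ih =>
    rw [List.foldr_cons, Function.comp_apply, hl g (by simp)]
    exact ih fun g' hg' => hl g' (List.mem_cons_of_mem _ hg')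

/-- Action of a commuting layer of reversible threshold gates: if the gates
`T i = Thr(S i, h i, t i)` pairwise commute, then their composition XORs onto each wire
`w` the XOR (= parity of the number) of the triggered threshold bits with head at `w`. -/
theorem commuting_threshold_layer {W : Type*} [Fintype W] [DecidableEq W] (k : ℕ)
    (S : Fin k → Finset W) (h : Fin k → W) (t : Fin k → ℕ)
    (hmem : ∀ i, h i ∉ S i)
    (hcomm : ∀ i j, thrGate (S i) (h i) (t i) ∘ thrGate (S j) (h j) (t j)
      = thrGate (S j) (h j) (t j) ∘ thrGate (S i) (h i) (t i)) :
    ∀ (a : W → Bool) (w : W),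
      ((List.ofFn fun i => thrGate (S i) (h i) (t i)).foldr (· ∘ ·) id) a w
        = xor (a w)
            (decide (Odd (Finset.univ.filter fun i =>
              h i = w ∧ t i ≤ ((S i).filter fun s => a s = true).card).card)) := by
  induction k with
  | zero => simp
  | succ k ih =>
    intro a w
    have ih' := ih (fun i => S i.succ) (fun i => h i.succ) (fun i => t i.succ)
      (fun i => hmem _) (fun i j => hcomm _ _) a
    have inv := List.foldr_comp_invariant
      (fun b : W → Bool => decide (t 0 ≤ ((S 0).filter fun s => b s = true).card))
      (List.ofFn fun i : Fin k => thrGate (S i.succ) (h i.succ) (t i.succ))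
      (fun g hg b => by
        obtain ⟨i, rfl⟩ := (List.mem_ofFn' _ _).mp hg
        exact thrGate_trigger_invariant (hmem 0) (hcomm 0 i.succ) b) a
    rw [List.ofFn_succ, List.foldr_cons, Function.comp_apply, Fin.card_filter_univ_succ]
    by_cases hw : w = h 0
    · subst hw
      rw [thrGate, if_pos rfl, inv, ih']
      by_cases ht : t 0 ≤ ((S 0).filter fun s => a s = true).card
      · simp [ht, Nat.odd_add_one, -Nat.not_odd_iff_even]
      · simp [ht]
    · rw [thrGate, if_neg hw, ih', if_neg fun hc => hw hc.1.symm]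
end

section
/- Let n ≥ 1 and 1 ≤ k ≤ n be integers, let θ = 2·arcsin(√(k/n)), and let R_y(θ) be the 2×2 real rotation matrix [[cos(θ/2), −sin(θ/2)], [sin(θ/2), cos(θ/2)]]. Let v = R_y(θ)^{⊗n} e_{0ⁿ} ∈ ℂ^{(Fin n → Fin 2)}, i.e., v is the column of the n-fold tensor power of R_y(θ) indexed by the all-zeros string. Then (i) for every x : Fin n → Fin 2, v(x) = (k/n)^{|x|/2} · ((n−k)/n)^{(n−|x|)/2}, where |x| is the Hamming weight of x; and (ii) ⟨D^n_k, v⟩ = √( (n choose k) · (k/n)^k · ((n−k)/n)^{n−k} ). -/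
noncomputable section

/-- The Hamming weight of a bit string `x : Fin n → Fin 2`. -/
def hammingWt {n : ℕ} (x : Fin n → Fin 2) : ℕ :=
  (Finset.univ.filter fun j => x j = 1).card

theorem hammingWt_le {n : ℕ} (x : Fin n → Fin 2) : hammingWt x ≤ n := by
  simpa [hammingWt] using
    Finset.card_le_card (Finset.filter_subset (fun j => x j = 1) Finset.univ)

/-- The number of bit strings of length `n` and Hamming weight `k` is `n.choose k`. -/
theorem card_filter_hammingWt_eq (n k : ℕ) :
    (Finset.univ.filter fun x : Fin n → Fin 2 => hammingWt x = k).card = n.choose k := by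
  have h : (Finset.powersetCard k (Finset.univ : Finset (Fin n))).card = n.choose k := by simp
  rw [← h]
  refine Finset.card_nbij' (fun x => Finset.univ.filter fun j => x j = 1)
    (fun s j => if j ∈ s then 1 else 0) ?_ ?_ ?_ ?_
  · intro x hx
    have hx' := (Finset.mem_filter.mp (Finset.mem_coe.mp hx)).2
    exact Finset.mem_coe.mpr (Finset.mem_powersetCard.mpr ⟨Finset.subset_univ _, hx'⟩)
  · intro s hs
    refine Finset.mem_coe.mpr (Finset.mem_filter.mpr ⟨Finset.mem_univ _, ?_⟩)
    simpa [hammingWt] using (Finset.mem_powersetCard.mp (Finset.mem_coe.mp hs)).2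
  · intro x _
    funext j
    by_cases hj : x j = 1
    · simp [hj]
    · simp only [Finset.mem_filter, Finset.mem_univ, true_and, hj, if_false]
      lia
  · intro s _
    ext j
    simp

/-- A product over the bits of `x` depends only on the Hamming weight of `x`. -/
theorem prod_apply_eq_pow_hammingWt {M : Type*} [CommMonoid M] {n : ℕ}
    (x : Fin n → Fin 2) (f : Fin 2 → M) :
    ∏ j, f (x j) = f 1 ^ hammingWt x * f 0 ^ (n - hammingWt x) := by
  have hcard : (Finset.univ.filter fun j => ¬ x j = 1).card = n - hammingWt x := by
    have := Finset.card_filter_add_card_filter_not (s := Finset.univ) (fun j => x j = 1)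
    simp only [Finset.card_univ, Fintype.card_fin] at this
    unfold hammingWt
    lia
  rw [← Finset.prod_filter_mul_prod_filter_not Finset.univ (fun j => x j = 1), ← hcard]
  congr 1
  · refine Finset.prod_eq_pow_card fun j hj => ?_
    rw [(Finset.mem_filter.mp hj).2]
  · refine Finset.prod_eq_pow_card fun j hj => ?_
    have := (Finset.mem_filter.mp hj).2
    rw [show x j = 0 by lia]

theorem sqrt_pow_eq_rpow_half {a : ℝ} (ha : 0 ≤ a) (m : ℕ) :
    Real.sqrt a ^ m = a ^ ((m : ℝ) / 2) := by
  rw [Real.sqrt_eq_rpow, ← Real.rpow_natCast, ← Real.rpow_mul ha]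
  congr 1
  ring

theorem sqrt_pow_eq_sqrt {a : ℝ} (ha : 0 ≤ a) (m : ℕ) :
    Real.sqrt a ^ m = Real.sqrt (a ^ m) := by
  rw [← Real.sqrt_sq (pow_nonneg (Real.sqrt_nonneg a) m), ← pow_mul, mul_comm, pow_mul,
    Real.sq_sqrt ha]

/-- Amplitude analysis of the product state `R_y(θ)^{⊗n} |0…0⟩` with
`θ = 2 arcsin √(k/n)`: its amplitudes are `(k/n)^{|x|/2} ((n−k)/n)^{(n−|x|)/2}`, and its
overlap with the Dicke state `D^n_k` is `√(C(n,k) (k/n)^k ((n−k)/n)^{n−k})`. -/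
theorem dicke_overlap (n k : ℕ) (hn : 1 ≤ n) (hk1 : 1 ≤ k) (hkn : k ≤ n)
    (θ : ℝ) (hθ : θ = 2 * Real.arcsin (Real.sqrt ((k : ℝ) / n)))
    (Ry : Matrix (Fin 2) (Fin 2) ℂ)
    (hRy : Ry = Matrix.of ![![(Real.cos (θ / 2) : ℂ), (-(Real.sin (θ / 2) : ℝ) : ℂ)],
                            ![(Real.sin (θ / 2) : ℂ), (Real.cos (θ / 2) : ℂ)]])
    (v : (Fin n → Fin 2) → ℂ) (hv : v = fun x => ∏ j, Ry (x j) 0)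
    (D : (Fin n → Fin 2) → ℂ)
    (hD : D = fun x => if hammingWt x = k
      then ((Real.sqrt (n.choose k) : ℝ)⁻¹ : ℂ) else 0) :
    (∀ x : Fin n → Fin 2,
      v x = ((((k : ℝ) / n) ^ ((hammingWt x : ℝ) / 2)
        * (((n : ℝ) - k) / n) ^ (((n : ℝ) - hammingWt x) / 2) : ℝ) : ℂ)) ∧
    ∑ x : Fin n → Fin 2, (starRingEnd ℂ) (D x) * v x
      = (Real.sqrt ((n.choose k : ℝ) * ((k : ℝ) / n) ^ k
          * (((n : ℝ) - k) / n) ^ (n - k)) : ℂ) := by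
  have hn0 : (0 : ℝ) < n := by exact_mod_cast hn
  have hkn' : (k : ℝ) ≤ n := by exact_mod_cast hkn
  have hp : 0 ≤ (k : ℝ) / n := by positivity
  have hp1 : (k : ℝ) / n ≤ 1 := (div_le_one hn0).mpr hkn'
  have hq : 0 ≤ ((n : ℝ) - k) / n := div_nonneg (sub_nonneg.mpr hkn') hn0.le
  have hhalf : θ / 2 = Real.arcsin (Real.sqrt ((k : ℝ) / n)) := by rw [hθ]; ring
  have hsin : Real.sin (θ / 2) = Real.sqrt ((k : ℝ) / n) := by
    rw [hhalf, Real.sin_arcsin (by linarith [Real.sqrt_nonneg ((k : ℝ) / n)])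
      (Real.sqrt_le_one.mpr hp1)]
  have hcos : Real.cos (θ / 2) = Real.sqrt (((n : ℝ) - k) / n) := by
    rw [hhalf, Real.cos_arcsin, Real.sq_sqrt hp, sub_div, div_self hn0.ne']
  have hamp (x : Fin n → Fin 2) : v x = ((Real.sqrt ((k : ℝ) / n) ^ hammingWt x
      * Real.sqrt (((n : ℝ) - k) / n) ^ (n - hammingWt x) : ℝ) : ℂ) := by
    rw [hv]
    refine (prod_apply_eq_pow_hammingWt x fun b => Ry b 0).trans ?_
    rw [hRy, hsin, hcos]
    simp
  refine ⟨fun x => ?_, ?_⟩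
  · rw [hamp, sqrt_pow_eq_rpow_half hp, sqrt_pow_eq_rpow_half hq,
      Nat.cast_sub (hammingWt_le x)]
  · have hterm (x : Fin n → Fin 2) : (starRingEnd ℂ) (D x) * v x =
        if hammingWt x = k then (((Real.sqrt (n.choose k))⁻¹ * (Real.sqrt ((k : ℝ) / n) ^ k
          * Real.sqrt (((n : ℝ) - k) / n) ^ (n - k)) : ℝ) : ℂ) else 0 := by
      rw [hamp, hD]
      by_cases hx : hammingWt x = k
      · simp only [hx, if_true]
        rw [← Complex.ofReal_inv, Complex.conj_ofReal, ← Complex.ofReal_mul]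
      · simp [hx]
    have hc2 : (n.choose k : ℝ) * (Real.sqrt (n.choose k))⁻¹ = Real.sqrt (n.choose k) := by
      rw [← div_eq_mul_inv, Real.div_sqrt]
    rw [Finset.sum_congr rfl fun x _ => hterm x, ← Finset.sum_filter, Finset.sum_const,
      card_filter_hammingWt_eq, nsmul_eq_mul, ← Complex.ofReal_natCast, ← Complex.ofReal_mul,
      ← mul_assoc, hc2, sqrt_pow_eq_sqrt hp, sqrt_pow_eq_sqrt hq, ← mul_assoc,
      ← Real.sqrt_mul (by positivity), ← Real.sqrt_mul (by positivity)]
end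
end

section
/- For all integers n ≥ 2 and k with 1 ≤ k ≤ n/2, the quantity p = (n choose k) · (k/n)^k · ((n−k)/n)^{n−k} satisfies 1/√(8k) ≤ p ≤ 1/√(πk). In particular p = Θ(k^{−1/2}) uniformly in n. -/
open Stirling in
/-- For `n = k + m`, the binomial probability at the mean, in terms of the Stirling sequence. -/
lemma choose_mul_pow_mul_pow_eq_stirlingSeq {k m : ℕ} (hk : k ≠ 0) (hm : m ≠ 0) :
    ((k + m).choose k : ℝ) * ((k : ℝ) / (k + m)) ^ k * ((m : ℝ) / (k + m)) ^ m =
      stirlingSeq (k + m) / (stirlingSeq k * stirlingSeq m) *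
        (√(2 * (k + m)) / (√(2 * k) * √(2 * m))) := by
  have hk' : (0 : ℝ) < k := by positivity
  have hm' : (0 : ℝ) < m := by positivity
  have h1 : (0 : ℝ) < √(2 * k) := by positivity
  have h2 : (0 : ℝ) < √(2 * m) := by positivity
  have h3 : (0 : ℝ) < √(2 * (k + m)) := by positivity
  have he := Real.exp_pos 1
  rw [Nat.cast_add_choose]
  simp only [stirlingSeq, Nat.cast_add, div_pow, pow_add]
  field_simp

open Stirling in
lemma stirlingSeq_pos {n : ℕ} (hn : n ≠ 0) : 0 < stirlingSeq n :=
  (Real.sqrt_pos.2 Real.pi_pos).trans_le (sqrt_pi_le_stirlingSeq hn)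

open Stirling in
lemma stirlingSeq_le_of_le {m n : ℕ} (hm : m ≠ 0) (h : m ≤ n) : stirlingSeq n ≤ stirlingSeq m := by
  obtain ⟨a, rfl⟩ := Nat.exists_eq_succ_of_ne_zero hm
  obtain ⟨b, rfl⟩ := Nat.exists_eq_succ_of_ne_zero (by omega : n ≠ 0)
  exact stirlingSeq'_antitone (Nat.succ_le_succ_iff.1 h)

open Stirling in
lemma stirlingSeq_two : stirlingSeq 2 = Real.exp 1 ^ 2 / 4 := by
  have h : √((2 : ℝ) * 2) = 2 := Real.sqrt_mul_self (by norm_num)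
  have he := Real.exp_pos 1
  simp only [stirlingSeq, Nat.cast_ofNat, h, Nat.factorial_two]
  field_simp
  norm_num

open Stirling in
lemma stirlingSeq_two_sq_le : stirlingSeq 2 ^ 2 ≤ 2 * √Real.pi := by
  rw [stirlingSeq_two]
  have h1 : Real.exp 1 ^ 4 ≤ 2.71829 ^ 4 :=
    pow_le_pow_left₀ (Real.exp_pos 1).le (by linarith [Real.exp_one_lt_d9]) 4
  have h2 : (1.77 : ℝ) ≤ √Real.pi := Real.le_sqrt_of_sq_le (by linarith [Real.pi_gt_d2])
  calc (Real.exp 1 ^ 2 / 4) ^ 2 = Real.exp 1 ^ 4 / 16 := by ring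
    _ ≤ 2 * √Real.pi := by norm_num at h1 h2 ⊢; linarith

lemma sqrt_eight_mul_inv_le_of_one {m : ℕ} (hm : m ≠ 0) :
    1 / √(8 : ℝ) ≤ ((1 + m : ℝ)) * (1 / (1 + m)) * ((m : ℝ) / (1 + m)) ^ m := by
  have hm' : (0 : ℝ) < m := by positivity
  have h1 : ((1 + m : ℝ) / m) ^ m ≤ Real.exp 1 := by
    calc ((1 + m : ℝ) / m) ^ m ≤ Real.exp (1 / m) ^ m := by
          gcongr
          have := Real.add_one_le_exp (1 / (m : ℝ))
          rwa [add_div, div_self hm'.ne']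
      _ = Real.exp 1 := by rw [← Real.exp_nat_mul]; congr 1; field_simp
  have h2 : Real.exp 1 ≤ √8 :=
    Real.le_sqrt_of_sq_le (by nlinarith [Real.exp_one_lt_d9, Real.exp_pos 1])
  calc 1 / √(8 : ℝ) ≤ 1 / ((1 + m : ℝ) / m) ^ m := by
        gcongr; exact h1.trans h2
    _ = _ := by
        rw [mul_one_div_cancel (by positivity), one_mul, one_div, ← inv_pow, inv_div]

open Stirling in
/-- The squared Dicke overlap `p = C(n,k) (k/n)^k ((n−k)/n)^{n−k}` satisfies
`1/√(8k) ≤ p ≤ 1/√(πk)` for `1 ≤ k ≤ n/2`; in particular `p = Θ(k^{−1/2})`. -/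
theorem dicke_overlap_bounds (n k : ℕ) (hn : 2 ≤ n) (hk : 1 ≤ k) (hkn : 2 * k ≤ n)
    (p : ℝ)
    (hp : p = (n.choose k : ℝ) * ((k : ℝ) / n) ^ k * (((n : ℝ) - k) / n) ^ (n - k)) :
    1 / Real.sqrt (8 * k) ≤ p ∧ p ≤ 1 / Real.sqrt (Real.pi * k) := by
  obtain ⟨m, rfl⟩ := Nat.exists_eq_add_of_le (by omega : k ≤ n)
  have hkm : k ≤ m := by omega
  have hk0 : k ≠ 0 := by omega
  have hm0 : m ≠ 0 := by omega
  have hk' : (0 : ℝ) < k := by positivity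
  have hm' : (0 : ℝ) < m := by positivity
  have hkm' : (k : ℝ) ≤ m := by exact_mod_cast hkm
  have hpi : 0 < √Real.pi := Real.sqrt_pos.2 Real.pi_pos
  have hsk := stirlingSeq_pos hk0
  have hsm := stirlingSeq_pos hm0
  have hsn := stirlingSeq_pos (by omega : k + m ≠ 0)
  rw [Nat.add_sub_cancel_left, Nat.cast_add, add_sub_cancel_left] at hp
  have hr : √(2 * (k + m) : ℝ) / (√(2 * k) * √(2 * m)) = √((k + m) / m) / √(2 * k) := by
    rw [mul_comm √(2 * k : ℝ), ← div_div, ← Real.sqrt_div (by positivity),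
      mul_div_mul_left _ _ two_ne_zero]
  have hp' := hp.trans (choose_mul_pow_mul_pow_eq_stirlingSeq hk0 hm0)
  rw [hr] at hp'
  constructor
  · rcases hk.eq_or_lt with rfl | hk2
    · rw [hp]
      simpa using sqrt_eight_mul_inv_le_of_one hm0
    · have h8 : √(8 * k : ℝ) = 2 * √(2 * k) := by
        rw [show (8 * k : ℝ) = 2 ^ 2 * (2 * k) by ring, Real.sqrt_mul (by positivity),
          Real.sqrt_sq zero_le_two]
      have h1 : 1 ≤ √((k + m) / m : ℝ) :=
        Real.one_le_sqrt.2 ((one_le_div hm').2 (by linarith))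
      have h2 : 1 / 2 ≤ stirlingSeq (k + m) / (stirlingSeq k * stirlingSeq m) := by
        rw [div_le_div_iff₀ two_pos (by positivity)]
        calc 1 * (stirlingSeq k * stirlingSeq m) ≤ stirlingSeq 2 ^ 2 := by
              rw [one_mul, sq]
              exact mul_le_mul (stirlingSeq_le_of_le two_ne_zero hk2)
                (stirlingSeq_le_of_le two_ne_zero (hk2.trans_le hkm)) hsm.le
                (stirlingSeq_pos two_ne_zero).le
          _ ≤ 2 * √Real.pi := stirlingSeq_two_sq_le
          _ ≤ stirlingSeq (k + m) * 2 := by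
              linarith [sqrt_pi_le_stirlingSeq (by omega : k + m ≠ 0)]
      calc 1 / √(8 * k : ℝ) = 1 / 2 * (1 / √(2 * k)) := by rw [h8, one_div_mul_one_div]
        _ ≤ p := by rw [hp']; gcongr
  · have h1 : √((k + m) / m : ℝ) ≤ √2 :=
      Real.sqrt_le_sqrt ((div_le_iff₀ hm').2 (by linarith))
    have h2 : stirlingSeq (k + m) / (stirlingSeq k * stirlingSeq m) ≤ 1 / √Real.pi := by
      rw [div_le_div_iff₀ (by positivity) hpi, one_mul, mul_comm]
      exact mul_le_mul (sqrt_pi_le_stirlingSeq hk0)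
        (stirlingSeq_le_of_le hm0 (Nat.le_add_left m k)) hsn.le hsk.le
    calc p ≤ 1 / √Real.pi * (√2 / √(2 * k)) := by rw [hp']; gcongr
      _ = 1 / √(Real.pi * k) := by
        rw [Real.sqrt_mul zero_le_two, Real.sqrt_mul Real.pi_pos.le]
        field_simp
end

section
/- Let A be an m×n matrix over the field 𝔽₂ and b ∈ 𝔽₂^m, and let r : [m̃] → [m] and c : [ñ] → [n] be surjective functions. Define the modified instance A′ ∈ 𝔽₂^{m̃×ñ} by A′(i,j) = A(r(i), c(j)) and b′ ∈ 𝔽₂^{m̃} by b′(i) = b(r(i)). Then the linear system A x = b has a solution x ∈ 𝔽₂^n if and only if the linear system A′ x′ = b′ has a solution x′ ∈ 𝔽₂^{ñ}. -/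
/-- Multiplying by a reindexed matrix amounts to first summing the vector over the fibres of the
column map. -/
theorem Matrix.submatrix_mulVec_eq_mulVec_fiber_sum {R l k p q : Type*}
    [NonUnitalNonAssocSemiring R] [Fintype p] [Fintype q] [DecidableEq p]
    (A : Matrix l p R) (r : k → l) (c : q → p) (y : q → R) :
    (A.submatrix r c).mulVec y = A.mulVec (fun j => ∑ i with c i = j, y i) ∘ r := by
  ext i
  simp only [Matrix.mulVec, dotProduct, Matrix.submatrix_apply, Function.comp_apply,
    Finset.mul_sum]
  rw [← Finset.sum_fiberwise Finset.univ c]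
  refine Finset.sum_congr rfl fun j _ => Finset.sum_congr rfl fun t ht => ?_
  rw [(Finset.mem_filter.mp ht).2]

/-- Every vector is the vector of fibre sums of some vector along a surjection. -/
theorem Function.Surjective.exists_fiber_sum_eq {R p q : Type*} [AddCommMonoid R]
    [Fintype q] [DecidableEq p] {c : q → p} (hc : Function.Surjective c) (x : p → R) :
    ∃ y : q → R, (fun j => ∑ i with c i = j, y i) = x := by
  classical
  obtain ⟨s, hs⟩ := hc.hasRightInverse
  refine ⟨fun i => if s (c i) = i then x (c i) else 0, funext fun j => ?_⟩
  rw [Finset.sum_eq_single_of_mem (s j) (by simp [hs j])]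
  · simp [hs j]
  · intro i hi hne
    rw [(Finset.mem_filter.mp hi).2, if_neg hne.symm]

/-- Invariance of XOR-SAT satisfiability under duplicating constraints (rows) and
variables (columns): if `r` and `c` are surjective and `A' = A(r i, c j)`,
`b' = b ∘ r`, then `A x = b` is solvable over `𝔽₂` iff `A' x' = b'` is solvable. -/
theorem xorsat_duplication_invariance (m n mt nt : ℕ)
    (A : Matrix (Fin m) (Fin n) (ZMod 2)) (b : Fin m → ZMod 2)
    (r : Fin mt → Fin m) (c : Fin nt → Fin n)
    (hr : Function.Surjective r) (hc : Function.Surjective c) :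
    (∃ x : Fin n → ZMod 2, A.mulVec x = b) ↔
    (∃ x' : Fin nt → ZMod 2, (A.submatrix r c).mulVec x' = b ∘ r) := by
  simp_rw [Matrix.submatrix_mulVec_eq_mulVec_fiber_sum, hr.injective_comp_right.eq_iff]
  constructor
  · rintro ⟨x, hx⟩
    obtain ⟨y, rfl⟩ := hc.exists_fiber_sum_eq x
    exact ⟨y, hx⟩
  · rintro ⟨y, hy⟩
    exact ⟨_, hy⟩
end
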